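/- Let α, β ∈ [-1/2, 1/2], set ρ_α = α/2 + 1/4 and ρ_β = β/2 + 1/4, and for each n ≥ 1 let P_n^{(α,β),monic} be the monic Jacobi polynomial of degree n. Then the sequence 2^{n-1+ρ_α+ρ_β} · sup_{x ∈ [-1,1]} (1-x)^{ρ_α} (1+x)^{ρ_β} |P_n^{(α,β),monic}(x)| converges to 1 as n → ∞; equivalently, sup_{x ∈ [-1,1]} (1-x)^{ρ_α} (1+x)^{ρ_β} |P_n^{(α,β),monic}(x)| is asymptotic to 2^{1-n-ρ_α-ρ_β}. -/

import Mathlib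

open MeasureTheory Filter

/-- The weighted sup `sup_{x ∈ [-1,1]} (1-x)^ρα (1+x)^ρβ |P(x)|`. -/
noncomputable def jacobiSup (ρa ρb : ℝ) (P : Polynomial ℝ) : ℝ :=
  sSup ((fun x : ℝ => (1 - x) ^ ρa * (1 + x) ^ ρb * |P.eval x|) '' Set.Icc (-1 : ℝ) 1)

/-- `P` is the monic Jacobi polynomial of degree `n` with parameters `α, β`. -/
def IsMonicJacobi (α β : ℝ) (n : ℕ) (P : Polynomial ℝ) : Prop :=
  P.Monic ∧ P.natDegree = n ∧
    ∀ k : ℕ, k < n →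
      ∫ x in (-1 : ℝ)..1, (1 - x) ^ α * (1 + x) ^ β * P.eval x * x ^ k = 0

/-- The Jacobi weight `(1 - x) ^ α * (1 + x) ^ β`. -/
noncomputable def jacobiWeight (α β x : ℝ) : ℝ := (1 - x) ^ α * (1 + x) ^ β

lemma beta_integrand_eq {α β x : ℝ} (hx : x ∈ Set.Ioc (0 : ℝ) 1) :
    (x : ℂ) ^ (((β + 1 : ℝ) : ℂ) - 1) * (1 - (x : ℂ)) ^ (((α + 1 : ℝ) : ℂ) - 1) =
      ((x ^ β * (1 - x) ^ α : ℝ) : ℂ) := by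
  rw [Complex.ofReal_mul, Complex.ofReal_cpow hx.1.le, Complex.ofReal_cpow (by linarith [hx.2])]
  push_cast
  simp

lemma intervalIntegrable_beta {α β : ℝ} (hα : -1 < α) (hβ : -1 < β) :
    IntervalIntegrable (fun x : ℝ => x ^ β * (1 - x) ^ α) volume 0 1 := by
  have h := Complex.betaIntegral_convergent (u := ((β + 1 : ℝ) : ℂ)) (v := ((α + 1 : ℝ) : ℂ))
    (by rw [Complex.ofReal_re]; linarith) (by rw [Complex.ofReal_re]; linarith)
  rw [intervalIntegrable_iff_integrableOn_Ioc_of_le zero_le_one] at h ⊢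
  refine (h.congr_fun (fun x hx => beta_integrand_eq hx) measurableSet_Ioc).re.congr ?_
  exact .of_forall fun x => by simp

lemma integral_beta {α β : ℝ} (hα : -1 < α) (hβ : -1 < β) :
    ∫ x in (0 : ℝ)..1, x ^ β * (1 - x) ^ α =
      Real.Gamma (α + 1) * Real.Gamma (β + 1) / Real.Gamma (α + β + 2) := by
  have h := ProbabilityTheory.beta_eq_betaIntegralReal (β + 1) (α + 1) (by linarith) (by linarith)
  have h2 : Complex.betaIntegral ((β + 1 : ℝ) : ℂ) ((α + 1 : ℝ) : ℂ) =
      ((∫ x in (0 : ℝ)..1, x ^ β * (1 - x) ^ α : ℝ) : ℂ) := by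
    rw [Complex.betaIntegral, ← intervalIntegral.integral_ofReal]
    refine intervalIntegral.integral_congr_ae (.of_forall fun x hx => ?_)
    rw [Set.uIoc_of_le zero_le_one] at hx
    exact beta_integrand_eq hx
  rw [h2, Complex.ofReal_re] at h
  rw [← h, ProbabilityTheory.beta, show β + 1 + (α + 1) = α + β + 2 by ring]
  ring

lemma jacobiWeight_comp {α β y : ℝ} (hy : y ∈ Set.Ioc (0 : ℝ) 1) :
    jacobiWeight α β (2 * y - 1) = 2 ^ (α + β) * (y ^ β * (1 - y) ^ α) := by
  rw [jacobiWeight, show 1 - (2 * y - 1) = 2 * (1 - y) by ring,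
    show 1 + (2 * y - 1) = 2 * y by ring, Real.mul_rpow (by norm_num) (by linarith [hy.2]),
    Real.mul_rpow (by norm_num) hy.1.le, Real.rpow_add (by norm_num)]
  ring

lemma intervalIntegrable_jacobiWeight {α β : ℝ} (hα : -1 < α) (hβ : -1 < β) :
    IntervalIntegrable (jacobiWeight α β) volume (-1) 1 := by
  have h := (intervalIntegrable_beta hα hβ).const_mul (2 ^ (α + β))
  have h2 : IntervalIntegrable (fun y => jacobiWeight α β (2 * y - 1)) volume 0 1 :=
    h.congr fun y hy => (jacobiWeight_comp (by rwa [Set.uIoc_of_le zero_le_one] at hy)).symm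
  have h3 := (h2.comp_mul_right (c := 1 / 2) (by norm_num)).comp_add_right 1
  norm_num at h3
  convert! h3 using 2 with x
  congr 1
  ring

lemma integral_jacobiWeight {α β : ℝ} (hα : -1 < α) (hβ : -1 < β) :
    ∫ x in (-1 : ℝ)..1, jacobiWeight α β x =
      2 ^ (α + β + 1) * (Real.Gamma (α + 1) * Real.Gamma (β + 1) / Real.Gamma (α + β + 2)) := by
  have h := intervalIntegral.integral_comp_mul_sub (a := 0) (b := 1) (jacobiWeight α β)
    (two_ne_zero (α := ℝ)) 1
  rw [intervalIntegral.integral_congr_ae (g := fun y => 2 ^ (α + β) * (y ^ β * (1 - y) ^ α))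
    (.of_forall fun y hy => jacobiWeight_comp (by rwa [Set.uIoc_of_le zero_le_one] at hy)),
    intervalIntegral.integral_const_mul, integral_beta hα hβ] at h
  norm_num at h
  rw [Real.rpow_add_one (by norm_num)]
  linarith

open Polynomial in
/-- The integral of a polynomial against the Jacobi weight, as a linear functional. -/
noncomputable def jacobiIntegral (α β : ℝ) (p : ℝ[X]) : ℝ :=
  ∫ x in (-1 : ℝ)..1, jacobiWeight α β x * p.eval x

section Functional

open Polynomial

variable {α β : ℝ}

lemma intervalIntegrable_jacobiWeight_mul (hα : -1 < α) (hβ : -1 < β) {f : ℝ → ℝ}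
    (hf : Continuous f) :
    IntervalIntegrable (fun x => jacobiWeight α β x * f x) volume (-1) 1 :=
  (intervalIntegrable_jacobiWeight hα hβ).mul_continuousOn hf.continuousOn

lemma jacobiIntegral_add (hα : -1 < α) (hβ : -1 < β) (p q : ℝ[X]) :
    jacobiIntegral α β (p + q) = jacobiIntegral α β p + jacobiIntegral α β q := by
  simp only [jacobiIntegral, eval_add, mul_add]
  exact intervalIntegral.integral_add (intervalIntegrable_jacobiWeight_mul hα hβ p.continuous)
    (intervalIntegrable_jacobiWeight_mul hα hβ q.continuous)

lemma jacobiIntegral_C_mul (c : ℝ) (p : ℝ[X]) :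
    jacobiIntegral α β (C c * p) = c * jacobiIntegral α β p := by
  simp only [jacobiIntegral, eval_mul, eval_C]
  rw [← intervalIntegral.integral_const_mul]
  exact intervalIntegral.integral_congr fun x _ => by ring

lemma jacobiIntegral_sum (hα : -1 < α) (hβ : -1 < β) (s : Finset ℕ) (f : ℕ → ℝ[X]) :
    jacobiIntegral α β (∑ i ∈ s, f i) = ∑ i ∈ s, jacobiIntegral α β (f i) := by
  induction s using Finset.cons_induction with
  | empty => simp [jacobiIntegral]
  | cons a s ha ih => rw [Finset.sum_cons, Finset.sum_cons, jacobiIntegral_add hα hβ, ih]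

lemma jacobiIntegral_one_sub_X_sq_mul (p : ℝ[X]) (hα : -1 < α) (hβ : -1 < β) :
    jacobiIntegral α β ((1 - X ^ 2) * p) = jacobiIntegral (α + 1) (β + 1) p := by
  refine intervalIntegral.integral_congr fun x hx => ?_
  rw [Set.uIcc_of_le (by norm_num)] at hx
  simp only [jacobiWeight, eval_mul, eval_sub, eval_one, eval_pow, eval_X]
  rw [Real.rpow_add_one' (by linarith [hx.2]) (by linarith),
    Real.rpow_add_one' (by linarith [hx.1]) (by linarith)]
  ring

/-- The adjoint of differentiation with respect to the Jacobi weight, times `1 - X ^ 2`. -/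
noncomputable def jacobiAdjoint (α β : ℝ) (p : ℝ[X]) : ℝ[X] :=
  (1 - X ^ 2) * derivative p + (C (β - α) - C (α + β + 2) * X) * p

lemma jacobiAdjoint_mul (p q : ℝ[X]) :
    jacobiAdjoint α β (p * q) = jacobiAdjoint α β p * q + (1 - X ^ 2) * (p * derivative q) := by
  simp only [jacobiAdjoint, derivative_mul]
  ring

lemma jacobiIntegral_jacobiAdjoint (hα : -1 < α) (hβ : -1 < β) (p : ℝ[X]) :
    jacobiIntegral α β (jacobiAdjoint α β p) = 0 := by
  have key := intervalIntegral.integral_eq_sub_of_hasDerivAt_of_le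
    (f := fun x => jacobiWeight (α + 1) (β + 1) x * p.eval x)
    (f' := fun x => jacobiWeight α β x * (jacobiAdjoint α β p).eval x)
    (a := -1) (b := 1) (by norm_num) ?_ ?_
    (intervalIntegrable_jacobiWeight_mul hα hβ (jacobiAdjoint α β p).continuous)
  · rw [jacobiIntegral, key]
    have h1 : α + 1 ≠ 0 := by linarith
    have h2 : β + 1 ≠ 0 := by linarith
    simp [jacobiWeight, Real.zero_rpow h1, Real.zero_rpow h2]
  · have h1 : 0 ≤ α + 1 := by linarith
    have h2 : 0 ≤ β + 1 := by linarith
    refine Continuous.continuousOn (Continuous.mul (Continuous.mul ?_ ?_) p.continuous)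
    · exact (continuous_const.sub continuous_id).rpow_const fun x => .inr h1
    · exact (continuous_const.add continuous_id).rpow_const fun x => .inr h2
  · intro x hx
    have hx1 : 0 < 1 - x := by linarith [hx.2]
    have hx2 : 0 < 1 + x := by linarith [hx.1]
    have d1 : HasDerivAt (fun y : ℝ => (1 - y) ^ (α + 1)) (-1 * (α + 1) * (1 - x) ^ α) x := by
      simpa using ((hasDerivAt_id x).const_sub 1).rpow_const (p := α + 1) (.inl hx1.ne')
    have d2 : HasDerivAt (fun y : ℝ => (1 + y) ^ (β + 1)) (1 * (β + 1) * (1 + x) ^ β) x := by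
      simpa using ((hasDerivAt_id x).const_add 1).rpow_const (p := β + 1) (.inl hx2.ne')
    refine ((d1.mul d2).mul (p.hasDerivAt x)).congr_deriv ?_
    simp only [jacobiWeight, jacobiAdjoint, eval_mul, eval_sub, eval_one, eval_pow, eval_X,
      eval_add, eval_C, Pi.mul_apply]
    rw [Real.rpow_add_one hx1.ne', Real.rpow_add_one hx2.ne']
    ring

/-- Integration by parts for the Jacobi weight. -/
lemma jacobiIntegral_jacobiAdjoint_mul (hα : -1 < α) (hβ : -1 < β) (p q : ℝ[X]) :
    jacobiIntegral α β (jacobiAdjoint α β p * q) =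
      -jacobiIntegral α β ((1 - X ^ 2) * (p * derivative q)) := by
  have h := jacobiIntegral_jacobiAdjoint hα hβ (p * q)
  rw [jacobiAdjoint_mul, jacobiIntegral_add hα hβ] at h
  linarith

lemma coeff_jacobiAdjoint_derivative (p : ℝ[X]) (k : ℕ) :
    (jacobiAdjoint α β (derivative p)).coeff k =
      (k + 2) * (k + 1) * p.coeff (k + 2) + (β - α) * (k + 1) * p.coeff (k + 1)
        - k * (k + α + β + 1) * p.coeff k := by
  have hX : ∀ (q : ℝ[X]) (j : ℕ), (X * derivative q).coeff j = j * q.coeff j := by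
    intro q j
    cases j with
    | zero => simp
    | succ j => rw [coeff_X_mul, coeff_derivative]; push_cast; ring
  have hM : jacobiAdjoint α β (derivative p) = derivative (derivative p)
      - X * derivative (X * derivative p) + C (β - α) * derivative p
      - C (α + β + 1) * (X * derivative p) := by
    simp only [jacobiAdjoint, derivative_mul, derivative_X, C_add, C_1, C_ofNat]
    ring
  rw [hM, coeff_sub, coeff_add, coeff_sub, coeff_C_mul, coeff_C_mul, hX, hX, coeff_derivative,
    coeff_derivative, coeff_derivative]
  push_cast
  ring

lemma eq_zero_of_jacobiIntegral_mul_self (hα : -1 < α) (hβ : -1 < β) {p : ℝ[X]}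
    (h : jacobiIntegral α β (p * p) = 0) : p = 0 := by
  by_contra hp
  refine h.not_gt ?_
  have hu_int := intervalIntegrable_jacobiWeight_mul hα hβ (p * p).continuous
  refine (intervalIntegral.integral_pos_iff_support_of_nonneg_ae' ?_ hu_int).2 ⟨by norm_num, ?_⟩
  · rw [Set.uIoc_of_le (by norm_num)]
    refine (ae_restrict_mem measurableSet_Ioc).mono fun x hx => ?_
    have := mul_self_nonneg (p.eval x)
    have h1 : 0 ≤ 1 - x := by linarith [hx.2]
    have h2 : 0 ≤ 1 + x := by linarith [hx.1]
    simp only [Pi.zero_apply, jacobiWeight, eval_mul]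
    positivity
  · have hsub : Set.Ioo (-1 : ℝ) 1 \ {x | p.IsRoot x} ⊆
        Function.support (fun x => jacobiWeight α β x * (p * p).eval x) ∩ Set.Ioc (-1) 1 := by
      rintro x ⟨hx, hr⟩
      refine ⟨?_, hx.1, hx.2.le⟩
      have h1 : 0 < 1 - x := by linarith [hx.2]
      have h2 : 0 < 1 + x := by linarith [hx.1]
      have hr' : p.eval x ≠ 0 := hr
      simp only [Function.mem_support, jacobiWeight, eval_mul]
      positivity
    refine lt_of_lt_of_le ?_ (measure_mono hsub)
    rw [measure_sdiff_null ((finite_setOfPred_isRoot hp).measure_zero _)]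
    simp

end Functional

section Jacobi

open Polynomial

variable {α β : ℝ} {n : ℕ} {p : ℝ[X]}

lemma IsMonicJacobi.jacobiIntegral_mul_eq_zero (hα : -1 < α) (hβ : -1 < β)
    (hp : IsMonicJacobi α β n p) {q : ℝ[X]} (hq : q.degree < n) :
    jacobiIntegral α β (q * p) = 0 := by
  rw [as_sum_range_C_mul_X_pow q, Finset.sum_mul, jacobiIntegral_sum hα hβ]
  refine Finset.sum_eq_zero fun k _ => ?_
  rw [mul_assoc, jacobiIntegral_C_mul]
  by_cases hk : k < n
  · have h := hp.2.2 k hk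
    have h2 : jacobiIntegral α β (X ^ k * p) = 0 := by
      rw [← h]
      refine intervalIntegral.integral_congr fun x _ => ?_
      simp only [jacobiWeight, eval_mul, eval_pow, eval_X]
      ring
    rw [h2, mul_zero]
  · rw [(degree_lt_iff_coeff_zero q n).1 hq k (not_lt.1 hk), zero_mul]

/-- The Jacobi differential equation. -/
lemma IsMonicJacobi.jacobiAdjoint_derivative (hα : -1 < α) (hβ : -1 < β)
    (hp : IsMonicJacobi α β n p) :
    jacobiAdjoint α β (derivative p) = C (-(n * (n + α + β + 1))) * p := by
  set Q : ℝ[X] := jacobiAdjoint α β (derivative p) + C (n * (n + α + β + 1)) * p with hQ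
  have hdeg : Q.degree < n := by
    rw [degree_lt_iff_coeff_zero]
    intro k hk
    have h0 : ∀ j, n < j → p.coeff j = 0 := fun j hj =>
      coeff_eq_zero_of_natDegree_lt (by rw [hp.2.1]; exact hj)
    rw [hQ, coeff_add, coeff_jacobiAdjoint_derivative, coeff_C_mul, h0 (k + 2) (by omega),
      h0 (k + 1) (by omega)]
    rcases hk.eq_or_lt with rfl | hk
    · ring
    · rw [h0 k hk]
      ring
  have horth : jacobiIntegral α β (Q * Q) = 0 := by
    nth_rewrite 1 [hQ]
    rw [add_mul, jacobiIntegral_add hα hβ, mul_assoc, jacobiIntegral_C_mul, mul_comm p,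
      hp.jacobiIntegral_mul_eq_zero hα hβ hdeg, jacobiIntegral_jacobiAdjoint_mul hα hβ,
      mul_comm (derivative p), ← jacobiIntegral_jacobiAdjoint_mul hα hβ,
      hp.jacobiIntegral_mul_eq_zero hα hβ, mul_zero, add_zero]
    rw [degree_lt_iff_coeff_zero] at hdeg ⊢
    intro k hk
    rw [coeff_jacobiAdjoint_derivative, hdeg k hk, hdeg (k + 1) (by omega),
      hdeg (k + 2) (by omega)]
    ring
  have := eq_zero_of_jacobiIntegral_mul_self hα hβ horth
  rw [hQ] at this
  rw [C_neg, neg_mul]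
  exact eq_neg_of_add_eq_zero_left this

lemma IsMonicJacobi.derivative (hα : -1 < α) (hβ : -1 < β) (hp : IsMonicJacobi α β (n + 1) p) :
    IsMonicJacobi (α + 1) (β + 1) n (C ((n + 1 : ℝ)⁻¹) * derivative p) := by
  have hn : (n + 1 : ℝ) ≠ 0 := by positivity
  have hc : (C ((n + 1 : ℝ)⁻¹) * Polynomial.derivative p).coeff n = 1 := by
    have := hp.1.coeff_natDegree
    rw [hp.2.1] at this
    rw [coeff_C_mul, coeff_derivative, this]
    field_simp
  have hle : (C ((n + 1 : ℝ)⁻¹) * Polynomial.derivative p).natDegree ≤ n := by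
    refine (natDegree_C_mul_le _ _).trans ((natDegree_derivative_le p).trans ?_)
    rw [hp.2.1]
    rfl
  refine ⟨monic_of_natDegree_le_of_coeff_eq_one n hle hc,
    natDegree_eq_of_le_of_coeff_ne_zero hle (by rw [hc]; exact one_ne_zero), fun k hk => ?_⟩
  have h1 : jacobiIntegral (α + 1) (β + 1) (C ((n + 1 : ℝ)⁻¹) * (X ^ k * Polynomial.derivative p))
      = 0 := by
    have hk0 : (k + 1 : ℝ) ≠ 0 := by positivity
    have h2 := jacobiIntegral_jacobiAdjoint_mul hα hβ (Polynomial.derivative (X ^ (k + 1))) p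
    have hdeg : (jacobiAdjoint α β (Polynomial.derivative (X ^ (k + 1)))).degree
        < (n + 1 : ℕ) := by
      rw [degree_lt_iff_coeff_zero]
      intro j hj
      rw [coeff_jacobiAdjoint_derivative, coeff_X_pow, coeff_X_pow, coeff_X_pow,
        if_neg (by omega), if_neg (by omega), if_neg (by omega)]
      ring
    rw [hp.jacobiIntegral_mul_eq_zero hα hβ hdeg, derivative_X_pow_succ, mul_assoc (C _),
      mul_left_comm (1 - X ^ 2), jacobiIntegral_C_mul, jacobiIntegral_one_sub_X_sq_mul _ hα hβ,
      zero_eq_neg] at h2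
    rw [jacobiIntegral_C_mul, (mul_eq_zero.1 h2).resolve_left hk0, mul_zero]
  rw [← h1]
  refine intervalIntegral.integral_congr fun x _ => ?_
  simp only [jacobiWeight, eval_mul, eval_pow, eval_X, eval_C]
  ring

lemma IsMonicJacobi.jacobiIntegral_mul_self_succ (hα : -1 < α) (hβ : -1 < β)
    (hp : IsMonicJacobi α β (n + 1) p) :
    (n + α + β + 2) * jacobiIntegral α β (p * p) = (n + 1) *
      jacobiIntegral (α + 1) (β + 1)
        ((C ((n + 1 : ℝ)⁻¹) * Polynomial.derivative p) *
          (C ((n + 1 : ℝ)⁻¹) * Polynomial.derivative p)) := by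
  have hn : (n + 1 : ℝ) ≠ 0 := by positivity
  have h := jacobiIntegral_jacobiAdjoint_mul hα hβ (Polynomial.derivative p) p
  rw [hp.jacobiAdjoint_derivative hα hβ, mul_assoc, jacobiIntegral_C_mul,
    jacobiIntegral_one_sub_X_sq_mul _ hα hβ] at h
  rw [mul_mul_mul_comm, ← C_mul, jacobiIntegral_C_mul]
  push_cast at h
  field_simp
  linarith

/-- The squared norm of the monic Jacobi polynomials. -/
lemma IsMonicJacobi.jacobiIntegral_mul_self (hα : -1 < α) (hβ : -1 < β)
    (hp : IsMonicJacobi α β n p) :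
    (∏ k ∈ Finset.range n, (n + α + β + 1 + k)) * jacobiIntegral α β (p * p) =
      n.factorial * 2 ^ (2 * n + α + β + 1) * (Real.Gamma (n + α + 1) * Real.Gamma (n + β + 1) /
        Real.Gamma (2 * n + α + β + 2)) := by
  induction n generalizing α β p with
  | zero =>
    have h1 : p = 1 := by
      have := hp.1
      rwa [Monic, leadingCoeff, hp.2.1, ← C_inj, ← eq_C_of_natDegree_eq_zero hp.2.1, C_1] at this
    have := integral_jacobiWeight hα hβ
    simp [h1, jacobiIntegral, this]
  | succ n ih =>
    have h := ih (by linarith) (by linarith) (hp.derivative hα hβ)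
    have h2 := hp.jacobiIntegral_mul_self_succ hα hβ
    rw [Finset.prod_range_succ', Nat.factorial_succ]
    have e1 : ∏ k ∈ Finset.range n, (((n + 1 : ℕ) : ℝ) + α + β + 1 + ((k + 1 : ℕ) : ℝ)) =
        ∏ k ∈ Finset.range n, (n + (α + 1) + (β + 1) + 1 + (k : ℝ)) :=
      Finset.prod_congr rfl fun k _ => by push_cast; ring
    rw [e1, mul_assoc]
    push_cast
    rw [show (n + 1 + α + β + 1 + 0 : ℝ) = n + α + β + 2 by ring, h2, mul_left_comm, h]
    rw [show (2 * n + (α + 1) + (β + 1) + 1 : ℝ) = 2 * (n + 1) + α + β + 1 by ring,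
      show (n + (α + 1) + 1 : ℝ) = n + 1 + α + 1 by ring,
      show (n + (β + 1) + 1 : ℝ) = n + 1 + β + 1 by ring,
      show (2 * n + (α + 1) + (β + 1) + 2 : ℝ) = 2 * (n + 1) + α + β + 2 by ring]
    ring

end Jacobi

section GammaAsymptotics

open Real

lemma tendsto_Gamma_div_of_pos {s : ℝ} (hs : 0 < s) :
    Tendsto (fun n : ℕ => Gamma (n + s + 1) / ((n : ℝ) ^ s * n.factorial)) atTop (nhds 1) := by
  have h := (tendsto_const_nhds (x := Gamma s)).div (GammaSeq_tendsto_Gamma s)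
    (Gamma_pos_of_pos hs).ne'
  rw [div_self (Gamma_pos_of_pos hs).ne'] at h
  refine h.congr fun n => ?_
  have hG : ∀ m : ℕ, (∏ j ∈ Finset.range m, (s + j)) * Gamma s = Gamma (s + m) := by
    intro m
    induction m with
    | zero => simp
    | succ m ih =>
      rw [Finset.prod_range_succ, mul_right_comm, ih, mul_comm]
      push_cast
      rw [← add_assoc, Gamma_add_one (by positivity)]
  have := hG (n + 1)
  rw [show (n + s + 1 : ℝ) = s + ((n + 1 : ℕ) : ℝ) by push_cast; ring, ← this]
  simp only [GammaSeq, Pi.div_apply]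
  rw [div_div_eq_mul_div, mul_comm]

lemma tendsto_Gamma_div_of_add_one {s : ℝ}
    (h : Tendsto (fun n : ℕ => Gamma (n + (s + 1) + 1) / ((n : ℝ) ^ (s + 1) * n.factorial)) atTop
      (nhds 1)) :
    Tendsto (fun n : ℕ => Gamma (n + s + 1) / ((n : ℝ) ^ s * n.factorial)) atTop (nhds 1) := by
  have h1 : Tendsto (fun n : ℕ => 1 + (s + 1) / (n : ℝ)) atTop (nhds 1) := by
    simpa using (tendsto_const_div_atTop_nhds_zero_nat (s + 1)).const_add 1
  have h2 := h.div h1 one_ne_zero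
  rw [div_one] at h2
  refine h2.congr' ?_
  filter_upwards [eventually_gt_atTop 0,
    (tendsto_natCast_atTop_atTop (R := ℝ)).eventually_gt_atTop (-(s + 1))] with n hn hn2
  have hn0 : (0 : ℝ) < n := by exact_mod_cast hn
  have hn3 : 0 < n + (s + 1) := by linarith
  have hf : (0 : ℝ) < n.factorial := by exact_mod_cast n.factorial_pos
  rw [Pi.div_apply, Gamma_add_one hn3.ne', rpow_add_one hn0.ne', add_assoc]
  have : 0 < (n : ℝ) ^ s := by positivity
  field_simp

lemma tendsto_Gamma_div {s : ℝ} (hs : -2 < s) :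
    Tendsto (fun n : ℕ => Gamma (n + s + 1) / ((n : ℝ) ^ s * n.factorial)) atTop (nhds 1) :=
  tendsto_Gamma_div_of_add_one (tendsto_Gamma_div_of_add_one
    (tendsto_Gamma_div_of_pos (by linarith)))

open Polynomial in
lemma tendsto_four_pow_mul_jacobiIntegral {α β : ℝ} (hα : -1 < α) (hβ : -1 < β)
    {P : ℕ → ℝ[X]} (hP : ∀ n : ℕ, 1 ≤ n → IsMonicJacobi α β n (P n)) :
    Tendsto (fun n : ℕ => 4 ^ n * jacobiIntegral α β (P n * P n)) atTop
      (nhds (π * 2 ^ (-(α + β)))) := by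
  have hdouble : Tendsto (fun n : ℕ => 2 * n) atTop atTop :=
    tendsto_id.const_mul_atTop' two_pos
  have hW := Wallis.tendsto_W_nhds_pi_div_two
  have h2 : Tendsto (fun n : ℕ => 2 + 1 / (n : ℝ)) atTop (nhds 2) := by
    simpa using (tendsto_const_div_atTop_nhds_zero_nat (1 : ℝ)).const_add 2
  have hR := ((((tendsto_Gamma_div (s := α) (by linarith)).mul
    (tendsto_Gamma_div (s := β) (by linarith))).mul
    (tendsto_Gamma_div (s := α + β) (by linarith))).div
    (((tendsto_Gamma_div (s := α + β) (by linarith)).comp hdouble).mul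
      ((tendsto_Gamma_div (s := α + β + 1) (by linarith)).comp hdouble)) (by norm_num)).mul
    ((hW.mul h2).mul_const (2 ^ (-(α + β))))
  convert! hR.congr' ?_ using 2
  · ring
  filter_upwards [eventually_ge_atTop 2] with n hn
  have hn2 : (2 : ℝ) ≤ n := by exact_mod_cast hn
  have hn0 : (0 : ℝ) < n := by linarith
  have hx : 0 < n + α + β + 1 := by linarith
  have hform := (hP n (by omega)).jacobiIntegral_mul_self hα hβ
  have hG : ∀ m : ℕ, (∏ j ∈ Finset.range m, (n + α + β + 1 + j)) * Gamma (n + α + β + 1) =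
      Gamma (n + α + β + 1 + m) := by
    intro m
    induction m with
    | zero => simp
    | succ m ih =>
      rw [Finset.prod_range_succ, mul_right_comm, ih, mul_comm]
      push_cast
      rw [← add_assoc, Gamma_add_one (by positivity)]
  have hprod := hG n
  rw [show (n + α + β + 1 + n : ℝ) = 2 * n + α + β + 1 by ring] at hprod
  have g1 : 0 < Gamma (n + α + β + 1) := Gamma_pos_of_pos hx
  have g2 : 0 < Gamma (2 * n + α + β + 1) := Gamma_pos_of_pos (by linarith)
  have g3 : 0 < Gamma (2 * n + α + β + 2) := Gamma_pos_of_pos (by linarith)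
  have hJ : jacobiIntegral α β (P n * P n) = n.factorial * 2 ^ (2 * n + α + β + 1) *
      (Gamma (n + α + 1) * Gamma (n + β + 1) / Gamma (2 * n + α + β + 2)) *
      Gamma (n + α + β + 1) / Gamma (2 * n + α + β + 1) := by
    rw [← hform, eq_div_iff g2.ne', ← hprod]
    ring
  rw [hJ]
  simp only [Pi.div_apply, Function.comp_apply]
  have hf : (0 : ℝ) < n.factorial := by exact_mod_cast n.factorial_pos
  have hf2 : (0 : ℝ) < (2 * n).factorial := by exact_mod_cast (2 * n).factorial_pos
  have hpow : (2 : ℝ) ^ (2 * n + α + β + 1) = 4 ^ n * (2 ^ α * 2 ^ β * 2) := by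
    rw [rpow_add_one (by norm_num), rpow_add (by norm_num), rpow_add (by norm_num),
      rpow_mul (by norm_num), rpow_natCast]
    norm_num
    ring
  have h16 : (2 : ℝ) ^ (4 * n) = (4 ^ n) ^ 2 := by
    rw [← pow_mul, show 4 * n = 2 * (n * 2) by ring, pow_mul]
    norm_num
  rw [Wallis.W_eq_factorial_ratio]
  push_cast
  rw [show (2 * n + (α + β) + 1 : ℝ) = 2 * n + α + β + 1 by ring,
    show (2 * n + (α + β + 1) + 1 : ℝ) = 2 * n + α + β + 2 by ring,
    show (n + (α + β) + 1 : ℝ) = n + α + β + 1 by ring,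
    rpow_add_one (by positivity), mul_rpow (by norm_num) hn0.le, hpow, h16,
    rpow_neg (by norm_num), rpow_add hn0, rpow_add (by norm_num : (0 : ℝ) < 2)]
  have k1 : (0 : ℝ) < (n : ℝ) ^ α := by positivity
  have k2 : (0 : ℝ) < (n : ℝ) ^ β := by positivity
  field_simp

end GammaAsymptotics

section Sonin

open Set

lemma le_exp_mul_of_hasDerivAt_ge {G G' : ℝ → ℝ} {a b κ : ℝ} (hab : a ≤ b)
    (hG : ∀ x ∈ Icc a b, HasDerivAt G (G' x) x) (h : ∀ x ∈ Icc a b, -(κ * G x) ≤ G' x) :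
    G a ≤ Real.exp (κ * (b - a)) * G b := by
  have hd : ∀ x ∈ Icc a b, HasDerivAt (fun y => Real.exp (κ * y) * G y)
      (Real.exp (κ * x) * (κ * G x + G' x)) x := fun x hx =>
    ((((hasDerivAt_id x).const_mul κ).exp).mul (hG x hx)).congr_deriv (by simp; ring)
  have hmono : MonotoneOn (fun y => Real.exp (κ * y) * G y) (Icc a b) := by
    refine monotoneOn_of_deriv_nonneg (convex_Icc a b) (HasDerivAt.continuousOn hd)
      (fun x hx => (hd x (interior_subset hx)).differentiableAt.differentiableWithinAt)
      fun x hx => ?_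
    rw [(hd x (interior_subset hx)).deriv]
    have := h x (interior_subset hx)
    exact mul_nonneg (Real.exp_pos _).le (by linarith)
  have h1 := hmono (left_mem_Icc.2 hab) (right_mem_Icc.2 hab) hab
  have h2 : Real.exp (κ * (b - a)) = Real.exp (κ * b) / Real.exp (κ * a) := by
    rw [← Real.exp_sub]
    ring_nf
  rw [h2, div_mul_eq_mul_div, le_div_iff₀ (Real.exp_pos _), mul_comm]
  exact h1

lemma le_exp_mul_of_hasDerivAt_le {G G' : ℝ → ℝ} {a b κ : ℝ} (hab : a ≤ b)
    (hG : ∀ x ∈ Icc a b, HasDerivAt G (G' x) x) (h : ∀ x ∈ Icc a b, G' x ≤ κ * G x) :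
    G b ≤ Real.exp (κ * (b - a)) * G a := by
  have h1 := le_exp_mul_of_hasDerivAt_ge (G := fun x => -G x) (G' := fun x => -G' x) (κ := -κ) hab
    (fun x hx => (hG x hx).neg) fun x hx => by linarith [h x hx]
  have h2 : Real.exp (κ * (b - a)) * Real.exp (-κ * (b - a)) = 1 := by
    rw [← Real.exp_add]
    simp
  have h3 := mul_le_mul_of_nonneg_left h1 (Real.exp_pos (κ * (b - a))).le
  rw [← mul_assoc, h2] at h3
  linarith

/-- The Sonin energy of a solution `u` with derivative `v` of the equation with potential `φ`. -/
noncomputable def soninEnergy (u v φ : ℝ → ℝ) (θ : ℝ) : ℝ := u θ ^ 2 + v θ ^ 2 / φ θ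

variable {u v φ φ' : ℝ → ℝ} {a b κ N : ℝ}

lemma hasDerivAt_soninEnergy {θ : ℝ} (hu : HasDerivAt u (v θ) θ)
    (hv : HasDerivAt v (-(φ θ * u θ)) θ) (hφ : HasDerivAt φ (φ' θ) θ) (hpos : 0 < φ θ) :
    HasDerivAt (soninEnergy u v φ) (-(v θ ^ 2 / φ θ * (φ' θ / φ θ))) θ := by
  refine ((hu.pow 2).add ((hv.pow 2).div hφ hpos.ne')).congr_deriv ?_
  simp only [Pi.pow_apply]
  field_simp
  ring

lemma soninEnergy_nonneg {θ : ℝ} (hpos : 0 < φ θ) : 0 ≤ soninEnergy u v φ θ := by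
  rw [soninEnergy]
  positivity

lemma sq_div_le_soninEnergy (θ : ℝ) : v θ ^ 2 / φ θ ≤ soninEnergy u v φ θ := by
  rw [soninEnergy]
  linarith [sq_nonneg (u θ)]

lemma sq_le_soninEnergy {θ : ℝ} (hpos : 0 < φ θ) : u θ ^ 2 ≤ soninEnergy u v φ θ := by
  have : 0 ≤ v θ ^ 2 / φ θ := by positivity
  rw [soninEnergy]
  linarith

lemma soninEnergy_le_right (hab : a ≤ b) (hu : ∀ θ ∈ Icc a b, HasDerivAt u (v θ) θ)
    (hv : ∀ θ ∈ Icc a b, HasDerivAt v (-(φ θ * u θ)) θ)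
    (hφ : ∀ θ ∈ Icc a b, HasDerivAt φ (φ' θ) θ) (hpos : ∀ θ ∈ Icc a b, 0 < φ θ)
    (hκ : 0 ≤ κ) (h : ∀ θ ∈ Icc a b, φ' θ ≤ κ * φ θ) :
    soninEnergy u v φ a ≤ Real.exp (κ * (b - a)) * soninEnergy u v φ b := by
  refine le_exp_mul_of_hasDerivAt_ge hab
    (fun x hx => hasDerivAt_soninEnergy (hu x hx) (hv x hx) (hφ x hx) (hpos x hx)) fun x hx => ?_
  have hx0 := hpos x hx
  have h1 : φ' x / φ x ≤ κ := (div_le_iff₀ hx0).2 (h x hx)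
  have h2 : 0 ≤ v x ^ 2 / φ x := by positivity
  nlinarith [mul_le_mul_of_nonneg_left h1 h2, sq_div_le_soninEnergy (u := u) (v := v) (φ := φ) x]

lemma soninEnergy_le_left (hab : a ≤ b) (hu : ∀ θ ∈ Icc a b, HasDerivAt u (v θ) θ)
    (hv : ∀ θ ∈ Icc a b, HasDerivAt v (-(φ θ * u θ)) θ)
    (hφ : ∀ θ ∈ Icc a b, HasDerivAt φ (φ' θ) θ) (hpos : ∀ θ ∈ Icc a b, 0 < φ θ)
    (hκ : 0 ≤ κ) (h : ∀ θ ∈ Icc a b, -(κ * φ θ) ≤ φ' θ) :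
    soninEnergy u v φ b ≤ Real.exp (κ * (b - a)) * soninEnergy u v φ a := by
  refine le_exp_mul_of_hasDerivAt_le hab
    (fun x hx => hasDerivAt_soninEnergy (hu x hx) (hv x hx) (hφ x hx) (hpos x hx)) fun x hx => ?_
  have hx0 := hpos x hx
  have h1 : -κ ≤ φ' x / φ x := (le_div_iff₀ hx0).2 (by linarith [h x hx])
  have h2 : 0 ≤ v x ^ 2 / φ x := by positivity
  nlinarith [mul_le_mul_of_nonneg_left h1 h2, sq_div_le_soninEnergy (u := u) (v := v) (φ := φ) x]

/-- Sturm comparison with `sin (N θ)`. -/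
lemma exists_eq_zero_of_sq_le (hN : 0 < N)
    (hu : ∀ θ ∈ Icc a (a + Real.pi / N), HasDerivAt u (v θ) θ)
    (hv : ∀ θ ∈ Icc a (a + Real.pi / N), HasDerivAt v (-(φ θ * u θ)) θ)
    (hφ : ∀ θ ∈ Icc a (a + Real.pi / N), N ^ 2 ≤ φ θ) :
    ∃ θ ∈ Icc a (a + Real.pi / N), u θ = 0 := by
  have hab : a ≤ a + Real.pi / N := by
    have := Real.pi_pos
    linarith [show 0 < Real.pi / N by positivity]
  by_contra! hne
  wlog hpos : 0 < u a generalizing u v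
  · refine this (u := fun θ => -u θ) (v := fun θ => -v θ) (fun θ hθ => (hu θ hθ).neg)
      (fun θ hθ => (hv θ hθ).neg.congr_deriv (by ring)) (fun θ hθ => neg_ne_zero.2 (hne θ hθ)) ?_
    have := hne a (left_mem_Icc.2 hab)
    exact neg_pos.2 (lt_of_le_of_ne (not_lt.1 hpos) this)
  have hcont : ContinuousOn u (Icc a (a + Real.pi / N)) := HasDerivAt.continuousOn hu
  have hall : ∀ θ ∈ Icc a (a + Real.pi / N), 0 < u θ := by
    intro θ hθ
    by_contra! hneg
    obtain ⟨z, hz, hz0⟩ := intermediate_value_Icc' hθ.1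
      (hcont.mono (Icc_subset_Icc_right hθ.2)) ⟨hneg, hpos.le⟩
    exact hne z ⟨hz.1, hz.2.trans hθ.2⟩ hz0
  have hd : ∀ x ∈ Icc a (a + Real.pi / N), HasDerivAt
      (fun θ => v θ * Real.sin (N * (θ - a)) - u θ * (N * Real.cos (N * (θ - a))))
      (-((φ x - N ^ 2) * u x * Real.sin (N * (x - a)))) x := by
    intro x hx
    have hlin : HasDerivAt (fun θ => N * (θ - a)) N x := by
      simpa using ((hasDerivAt_id x).sub_const a).const_mul N
    refine (((hv x hx).mul hlin.sin).sub ((hu x hx).mul (hlin.cos.const_mul N))).congr_deriv ?_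
    ring
  have hanti := antitoneOn_of_deriv_nonpos (convex_Icc a (a + Real.pi / N))
    (HasDerivAt.continuousOn hd)
    (fun x hx => (hd x (interior_subset hx)).differentiableAt.differentiableWithinAt)
    (fun x hx => by
      have hx := interior_subset hx
      rw [(hd x hx).deriv, neg_nonpos]
      refine mul_nonneg (mul_nonneg (sub_nonneg.2 (hφ x hx)) (hall x hx).le)
        (Real.sin_nonneg_of_nonneg_of_le_pi (mul_nonneg hN.le (sub_nonneg.2 hx.1)) ?_)
      have : x - a ≤ Real.pi / N := by linarith [hx.2]
      rwa [le_div_iff₀ hN, mul_comm] at this)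
  have h1 := hanti (left_mem_Icc.2 hab) (right_mem_Icc.2 hab) hab
  have h2 : N * (a + Real.pi / N - a) = Real.pi := by field_simp; ring
  simp only [h2, Real.sin_pi, Real.cos_pi, sub_self, mul_zero, Real.sin_zero, Real.cos_zero] at h1
  nlinarith [hall _ (left_mem_Icc.2 hab), hall _ (right_mem_Icc.2 hab)]

lemma exists_soninEnergy_eq_sq (hN : 0 < N) (hab : 2 * (Real.pi / N) < b - a)
    (hu : ∀ θ ∈ Icc a b, HasDerivAt u (v θ) θ)
    (hv : ∀ θ ∈ Icc a b, HasDerivAt v (-(φ θ * u θ)) θ)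
    (hφ : ∀ θ ∈ Icc a b, N ^ 2 ≤ φ θ) :
    ∃ θ ∈ Icc a b, soninEnergy u v φ θ = u θ ^ 2 := by
  have hp : 0 < Real.pi / N := by
    have := Real.pi_pos
    positivity
  have hs1 : Icc a (a + Real.pi / N) ⊆ Icc a b := Icc_subset_Icc_right (by linarith)
  have hs2 : Icc (b - Real.pi / N) (b - Real.pi / N + Real.pi / N) ⊆ Icc a b :=
    Icc_subset_Icc (by linarith) (by linarith)
  obtain ⟨x, hx, hx0⟩ := exists_eq_zero_of_sq_le hN (fun θ h => hu θ (hs1 h))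
    (fun θ h => hv θ (hs1 h)) (fun θ h => hφ θ (hs1 h))
  obtain ⟨y, hy, hy0⟩ := exists_eq_zero_of_sq_le hN (fun θ h => hu θ (hs2 h))
    (fun θ h => hv θ (hs2 h)) (fun θ h => hφ θ (hs2 h))
  have hxy : x < y := by linarith [hx.2, hy.1]
  have hsub : Icc x y ⊆ Icc a b := Icc_subset_Icc (hs1 hx).1 (hs2 hy).2
  obtain ⟨z, hz, hz0⟩ := exists_hasDerivAt_eq_zero hxy
    (HasDerivAt.continuousOn fun θ h => hu θ (hsub h)) (hx0.trans hy0.symm)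
    (fun θ h => hu θ (hsub (Ioo_subset_Icc_self h)))
  refine ⟨z, hsub (Ioo_subset_Icc_self hz), ?_⟩
  simp [soninEnergy, hz0]

lemma abs_mul_div_le_soninEnergy {θ : ℝ} (hN : 0 < N) (hφ : N ^ 2 ≤ φ θ) :
    |u θ * v θ / φ θ| ≤ soninEnergy u v φ θ / (2 * N) := by
  have hpos : 0 < φ θ := lt_of_lt_of_le (by positivity) hφ
  have h1 : soninEnergy u v φ θ = (φ θ * u θ ^ 2 + v θ ^ 2) / φ θ := by
    rw [soninEnergy]
    field_simp
  rw [h1, abs_div, abs_of_pos hpos, div_div, div_le_div_iff₀ hpos (by positivity), abs_mul]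
  have h2 := mul_le_mul_of_nonneg_right hφ (sq_nonneg (u θ))
  have h3 : |u θ| * |v θ| * (2 * N) ≤ φ θ * u θ ^ 2 + v θ ^ 2 := by
    have := sq_nonneg (N * |u θ| - |v θ|)
    nlinarith [sq_abs (u θ), sq_abs (v θ)]
  nlinarith

/-- Equipartition of the Sonin energy of an oscillating solution. -/
lemma integral_two_mul_sq_mem_Icc {m M : ℝ} (hab : a ≤ b) (hN : 0 < N)
    (hu : ∀ θ ∈ Icc a b, HasDerivAt u (v θ) θ)
    (hv : ∀ θ ∈ Icc a b, HasDerivAt v (-(φ θ * u θ)) θ)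
    (hφ : ∀ θ ∈ Icc a b, HasDerivAt φ (φ' θ) θ) (hpos : ∀ θ ∈ Icc a b, N ^ 2 ≤ φ θ)
    (h : ∀ θ ∈ Icc a b, |φ' θ| ≤ κ * φ θ)
    (hm : ∀ θ ∈ Icc a b, m ≤ soninEnergy u v φ θ) (hM : ∀ θ ∈ Icc a b, soninEnergy u v φ θ ≤ M) :
    ∫ θ in a..b, 2 * u θ ^ 2 ∈ Icc ((b - a) * (m - κ * (M / (2 * N))) - M / N)
      ((b - a) * (M + κ * (M / (2 * N))) + M / N) := by
  have hu_int : IntegrableOn (fun θ => 2 * u θ ^ 2) (Icc a b) :=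
    (continuousOn_const.mul ((HasDerivAt.continuousOn hu).pow 2)).integrableOn_Icc
  have hd : ∀ c : ℝ, ∀ x ∈ Icc a b, HasDerivAt (fun θ => c * θ - u θ * v θ / φ θ)
      (c - (v x ^ 2 / φ x - u x ^ 2 - u x * v x / φ x * (φ' x / φ x))) x := by
    intro c x hx
    have hx0 : 0 < φ x := lt_of_lt_of_le (by positivity) (hpos x hx)
    refine (((hasDerivAt_id x).const_mul c).sub
      (((hu x hx).mul (hv x hx)).div (hφ x hx) hx0.ne')).congr_deriv ?_
    simp only [Pi.mul_apply]
    field_simp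
    ring
  have hH : ∀ x ∈ Icc a b, |u x * v x / φ x| ≤ M / (2 * N) := fun x hx =>
    (abs_mul_div_le_soninEnergy hN (hpos x hx)).trans (by gcongr; exact hM x hx)
  have hr : ∀ x ∈ Icc a b, |u x * v x / φ x * (φ' x / φ x)| ≤ κ * (M / (2 * N)) := by
    intro x hx
    have hx0 : 0 < φ x := lt_of_lt_of_le (by positivity) (hpos x hx)
    rw [abs_mul, mul_comm κ]
    refine mul_le_mul (hH x hx) ?_ (abs_nonneg _) ((abs_nonneg _).trans (hH x hx))
    rw [abs_div, abs_of_pos hx0]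
    exact (div_le_iff₀ hx0).2 (h x hx)
  have ha := abs_le.1 (hH a (left_mem_Icc.2 hab))
  have hb := abs_le.1 (hH b (right_mem_Icc.2 hab))
  have hMN : M / N = M / (2 * N) + M / (2 * N) := by field_simp; ring
  constructor
  · have := intervalIntegral.sub_le_integral_of_hasDeriv_right_of_le hab
      (HasDerivAt.continuousOn (hd (m - κ * (M / (2 * N)))))
      (fun x hx => (hd _ x (Ioo_subset_Icc_self hx)).hasDerivWithinAt) hu_int (fun x hx => by
        have hx := Ioo_subset_Icc_self hx
        have h1 := hm x hx
        have h2 := abs_le.1 (hr x hx)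
        rw [soninEnergy] at h1
        linarith)
    rw [hMN]
    linarith
  · have := intervalIntegral.integral_le_sub_of_hasDeriv_right_of_le hab
      (HasDerivAt.continuousOn (hd (M + κ * (M / (2 * N)))))
      (fun x hx => (hd _ x (Ioo_subset_Icc_self hx)).hasDerivWithinAt) hu_int (fun x hx => by
        have hx := Ioo_subset_Icc_self hx
        have h1 := hM x hx
        have h2 := abs_le.1 (hr x hx)
        rw [soninEnergy] at h1
        linarith)
    rw [hMN]
    linarith

end Sonin

section Trigonometric

open Set

/-- The potential of the Jacobi equation in Liouville normal form. -/
noncomputable def jacobiPotential (A B N θ : ℝ) : ℝ :=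
  N ^ 2 + A / (1 - Real.cos θ) + B / (1 + Real.cos θ)

/-- The derivative of `jacobiPotential`. -/
noncomputable def jacobiPotentialDeriv (A B θ : ℝ) : ℝ :=
  B * (Real.sin θ / (1 + Real.cos θ) ^ 2) - A * (Real.sin θ / (1 - Real.cos θ) ^ 2)

lemma cos_mem_Ioo {θ : ℝ} (hθ : θ ∈ Ioo 0 Real.pi) : Real.cos θ ∈ Ioo (-1 : ℝ) 1 := by
  have h1 := Real.strictAntiOn_cos ⟨hθ.1.le, hθ.2.le⟩ (right_mem_Icc.2 Real.pi_pos.le) hθ.2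
  have h2 := Real.strictAntiOn_cos (left_mem_Icc.2 Real.pi_pos.le) ⟨hθ.1.le, hθ.2.le⟩ hθ.1
  rw [Real.cos_pi] at h1
  rw [Real.cos_zero] at h2
  exact ⟨h1, h2⟩

lemma hasDerivAt_jacobiPotential (A B N : ℝ) {θ : ℝ} (hθ : θ ∈ Ioo 0 Real.pi) :
    HasDerivAt (jacobiPotential A B N) (jacobiPotentialDeriv A B θ) θ := by
  obtain ⟨h1, h2⟩ := cos_mem_Ioo hθ
  have d1 := (hasDerivAt_const θ A).div ((Real.hasDerivAt_cos θ).const_sub 1) (by linarith)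
  have d2 := (hasDerivAt_const θ B).div ((Real.hasDerivAt_cos θ).const_add 1) (by linarith)
  refine ((d1.const_add (N ^ 2)).add d2).congr_deriv ?_
  rw [jacobiPotentialDeriv]
  ring

lemma sq_le_jacobiPotential {A B N θ : ℝ} (hA : 0 ≤ A) (hB : 0 ≤ B) (hθ : θ ∈ Ioo 0 Real.pi) :
    N ^ 2 ≤ jacobiPotential A B N θ := by
  obtain ⟨h1, h2⟩ := cos_mem_Ioo hθ
  have i1 : 0 ≤ A / (1 - Real.cos θ) := div_nonneg hA (by linarith)
  have i2 : 0 ≤ B / (1 + Real.cos θ) := div_nonneg hB (by linarith)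
  rw [jacobiPotential]
  linarith

lemma sin_div_sq_mem_Icc {θ c d : ℝ} (hθ : θ ∈ Ioo 0 Real.pi) (hd : 0 < d) (hc : d ≤ c) :
    Real.sin θ / c ^ 2 ∈ Icc 0 (1 / d ^ 2) := by
  have hs := Real.sin_pos_of_pos_of_lt_pi hθ.1 hθ.2
  refine ⟨by positivity, ?_⟩
  gcongr
  exact Real.sin_le_one θ

lemma sq_div_five_le_one_sub_cos {δ θ : ℝ} (hδ : 0 < δ) (hθ : θ ∈ Icc δ Real.pi) :
    δ ^ 2 / 5 ≤ 1 - Real.cos θ := by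
  have h := Real.cos_le_one_sub_mul_cos_sq (x := θ)
    (abs_le.2 ⟨by linarith [Real.pi_pos, hθ.1], hθ.2⟩)
  have h1 : δ ^ 2 ≤ θ ^ 2 := by gcongr; exact hθ.1
  have h2 : 1 / 5 ≤ 2 / Real.pi ^ 2 := by
    rw [div_le_div_iff₀ (by norm_num) (by have := Real.pi_pos; positivity)]
    nlinarith [Real.pi_lt_d2, Real.pi_pos]
  nlinarith [sq_nonneg δ]

variable {A B N : ℝ} {u v : ℝ → ℝ}

lemma abs_jacobiPotentialDeriv_le (hA : A ∈ Icc (0 : ℝ) (1 / 8)) (hB : B ∈ Icc (0 : ℝ) (1 / 8))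
    {δ θ : ℝ} (hδ : 0 < δ) (hθ : θ ∈ Icc δ (Real.pi - δ)) :
    |jacobiPotentialDeriv A B θ| ≤ 7 / δ ^ 4 := by
  have hθ0 : θ ∈ Ioo 0 Real.pi := ⟨by linarith [hθ.1], by linarith [hθ.2]⟩
  have h1 := sq_div_five_le_one_sub_cos hδ ⟨hθ.1, by linarith [hθ.2]⟩
  have h2 := sq_div_five_le_one_sub_cos (θ := Real.pi - θ) hδ ⟨by linarith [hθ.2],
    by linarith [hθ.1]⟩
  rw [Real.cos_pi_sub, sub_neg_eq_add] at h2
  obtain ⟨i1, i2⟩ := sin_div_sq_mem_Icc hθ0 (by positivity) h1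
  obtain ⟨i3, i4⟩ := sin_div_sq_mem_Icc hθ0 (by positivity) h2
  have e : 1 / (δ ^ 2 / 5) ^ 2 = 25 * (1 / δ ^ 4) := by field_simp; norm_num
  have e2 : 7 / δ ^ 4 = 7 * (1 / δ ^ 4) := by ring
  have hp : 0 < 1 / δ ^ 4 := by positivity
  rw [e] at i2 i4
  rw [jacobiPotentialDeriv, abs_le, e2]
  have j1 := mul_le_mul hA.2 i2 i1 (by norm_num)
  have j2 := mul_le_mul hB.2 i4 i3 (by norm_num)
  have j3 := mul_nonneg hA.1 i1
  have j4 := mul_nonneg hB.1 i3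
  constructor <;> linarith

lemma abs_jacobiPotentialDeriv_le_mul (hA : A ∈ Icc (0 : ℝ) (1 / 8))
    (hB : B ∈ Icc (0 : ℝ) (1 / 8)) (hN : 0 < N) {δ θ : ℝ} (hδ : 0 < δ)
    (hθ : θ ∈ Icc δ (Real.pi - δ)) :
    |jacobiPotentialDeriv A B θ| ≤ 7 / (δ ^ 4 * N ^ 2) * jacobiPotential A B N θ := by
  refine (abs_jacobiPotentialDeriv_le hA hB hδ hθ).trans ?_
  calc 7 / δ ^ 4 = 7 / (δ ^ 4 * N ^ 2) * N ^ 2 := by field_simp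
    _ ≤ _ := by
      gcongr
      exact sq_le_jacobiPotential hA.1 hB.1 ⟨by linarith [hθ.1], by linarith [hθ.2]⟩

lemma soninEnergy_le_exp_mul_midpoint (hA : A ∈ Icc (0 : ℝ) (1 / 8))
    (hB : B ∈ Icc (0 : ℝ) (1 / 8)) (hN : 0 < N)
    (hu : ∀ θ ∈ Ioo 0 Real.pi, HasDerivAt u (v θ) θ)
    (hv : ∀ θ ∈ Ioo 0 Real.pi, HasDerivAt v (-(jacobiPotential A B N θ * u θ)) θ)
    {θ : ℝ} (hθ : θ ∈ Ioo 0 Real.pi) :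
    soninEnergy u v (jacobiPotential A B N) θ ≤
      Real.exp (1 / N ^ 2 * Real.pi) * soninEnergy u v (jacobiPotential A B N) (Real.pi / 2) := by
  have hpi := Real.pi_pos
  have hmid : Real.pi / 2 ∈ Ioo 0 Real.pi := ⟨by linarith, by linarith⟩
  have hpos : ∀ x ∈ Ioo 0 Real.pi, 0 < jacobiPotential A B N x := fun x hx =>
    lt_of_lt_of_le (by positivity) (sq_le_jacobiPotential hA.1 hB.1 hx)
  have hone : ∀ x ∈ Ioo 0 Real.pi, 1 ≤ 1 / N ^ 2 * jacobiPotential A B N x := fun x hx => by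
    rw [one_div, ← div_eq_inv_mul, le_div_iff₀ (by positivity), one_mul]
    exact sq_le_jacobiPotential hA.1 hB.1 hx
  have hexp : ∀ c ≤ Real.pi, Real.exp (1 / N ^ 2 * c) *
      soninEnergy u v (jacobiPotential A B N) (Real.pi / 2) ≤ Real.exp (1 / N ^ 2 * Real.pi) *
      soninEnergy u v (jacobiPotential A B N) (Real.pi / 2) := fun c hc => by
    have := soninEnergy_nonneg (u := u) (v := v) (hpos _ hmid)
    gcongr
  rcases le_total θ (Real.pi / 2) with h | h
  · have hs : Icc θ (Real.pi / 2) ⊆ Ioo 0 Real.pi := fun x hx =>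
      ⟨by linarith [hx.1, hθ.1], by linarith [hx.2]⟩
    refine (soninEnergy_le_right h (fun x hx => hu x (hs hx)) (fun x hx => hv x (hs hx))
      (fun x hx => hasDerivAt_jacobiPotential A B N (hs hx)) (fun x hx => hpos x (hs hx))
      (κ := 1 / N ^ 2) (by positivity) fun x hx => ?_).trans (hexp _ (by linarith [hθ.1]))
    refine le_trans ?_ (hone x (hs hx))
    have hc := Real.cos_nonneg_of_neg_pi_div_two_le_of_le (x := x) (by linarith [(hs hx).1]) hx.2
    obtain ⟨i1, i2⟩ := sin_div_sq_mem_Icc (hs hx) one_pos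
      (show 1 ≤ 1 + Real.cos x by linarith)
    have hs0 := Real.sin_pos_of_pos_of_lt_pi (hs hx).1 (hs hx).2
    have i3 : 0 ≤ A * (Real.sin x / (1 - Real.cos x) ^ 2) := mul_nonneg hA.1 (by positivity)
    have j2 := mul_le_mul hB.2 i2 i1 (by norm_num)
    rw [jacobiPotentialDeriv]
    linarith
  · have hs : Icc (Real.pi / 2) θ ⊆ Ioo 0 Real.pi := fun x hx =>
      ⟨by linarith [hx.1], by linarith [hx.2, hθ.2]⟩
    refine (soninEnergy_le_left h (fun x hx => hu x (hs hx)) (fun x hx => hv x (hs hx))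
      (fun x hx => hasDerivAt_jacobiPotential A B N (hs hx)) (fun x hx => hpos x (hs hx))
      (κ := 1 / N ^ 2) (by positivity) fun x hx => ?_).trans (hexp _ (by linarith [hθ.2]))
    refine le_trans (neg_le_neg (hone x (hs hx))) ?_
    have hc := Real.cos_nonpos_of_pi_div_two_le_of_le hx.1 (by linarith [(hs hx).2])
    obtain ⟨i1, i2⟩ := sin_div_sq_mem_Icc (hs hx) one_pos
      (show 1 ≤ 1 - Real.cos x by linarith)
    have hs0 := Real.sin_pos_of_pos_of_lt_pi (hs hx).1 (hs hx).2
    have i3 : 0 ≤ B * (Real.sin x / (1 + Real.cos x) ^ 2) := mul_nonneg hB.1 (by positivity)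
    have j2 := mul_le_mul hA.2 i2 i1 (by norm_num)
    rw [jacobiPotentialDeriv]
    linarith

lemma midpoint_le_exp_mul_soninEnergy (hA : A ∈ Icc (0 : ℝ) (1 / 8))
    (hB : B ∈ Icc (0 : ℝ) (1 / 8)) (hN : 0 < N)
    (hu : ∀ θ ∈ Ioo 0 Real.pi, HasDerivAt u (v θ) θ)
    (hv : ∀ θ ∈ Ioo 0 Real.pi, HasDerivAt v (-(jacobiPotential A B N θ * u θ)) θ)
    {δ θ : ℝ} (hδ : 0 < δ) (hδ2 : δ ≤ Real.pi / 2) (hθ : θ ∈ Icc δ (Real.pi - δ)) :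
    soninEnergy u v (jacobiPotential A B N) (Real.pi / 2) ≤
      Real.exp (7 / (δ ^ 4 * N ^ 2) * Real.pi) * soninEnergy u v (jacobiPotential A B N) θ := by
  have hpi := Real.pi_pos
  have hs : Icc δ (Real.pi - δ) ⊆ Ioo 0 Real.pi := fun x hx =>
    ⟨by linarith [hx.1], by linarith [hx.2]⟩
  have hmid : Real.pi / 2 ∈ Icc δ (Real.pi - δ) := ⟨hδ2, by linarith⟩
  have hpos : ∀ x ∈ Ioo 0 Real.pi, 0 < jacobiPotential A B N x := fun x hx =>
    lt_of_lt_of_le (by positivity) (sq_le_jacobiPotential hA.1 hB.1 hx)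
  have hbd : ∀ x ∈ Icc δ (Real.pi - δ), |jacobiPotentialDeriv A B x| ≤
      7 / (δ ^ 4 * N ^ 2) * jacobiPotential A B N x := fun x hx =>
    abs_jacobiPotentialDeriv_le_mul hA hB hN hδ hx
  have hexp : ∀ c ≤ Real.pi, Real.exp (7 / (δ ^ 4 * N ^ 2) * c) *
      soninEnergy u v (jacobiPotential A B N) θ ≤ Real.exp (7 / (δ ^ 4 * N ^ 2) * Real.pi) *
      soninEnergy u v (jacobiPotential A B N) θ := fun c hc => by
    have := soninEnergy_nonneg (u := u) (v := v) (hpos _ (hs hθ))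
    gcongr
  rcases le_total θ (Real.pi / 2) with h | h
  · have hs2 : Icc θ (Real.pi / 2) ⊆ Icc δ (Real.pi - δ) := Icc_subset_Icc hθ.1 hmid.2
    exact (soninEnergy_le_left h (fun x hx => hu x (hs (hs2 hx)))
      (fun x hx => hv x (hs (hs2 hx)))
      (fun x hx => hasDerivAt_jacobiPotential A B N (hs (hs2 hx)))
      (fun x hx => hpos x (hs (hs2 hx))) (κ := 7 / (δ ^ 4 * N ^ 2)) (by positivity)
      fun x hx => (abs_le.1 (hbd x (hs2 hx))).1).trans (hexp _ (by linarith [hθ.1]))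
  · have hs2 : Icc (Real.pi / 2) θ ⊆ Icc δ (Real.pi - δ) := Icc_subset_Icc hmid.1 hθ.2
    exact (soninEnergy_le_right h (fun x hx => hu x (hs (hs2 hx)))
      (fun x hx => hv x (hs (hs2 hx)))
      (fun x hx => hasDerivAt_jacobiPotential A B N (hs (hs2 hx)))
      (fun x hx => hpos x (hs (hs2 hx))) (κ := 7 / (δ ^ 4 * N ^ 2)) (by positivity)
      fun x hx => (abs_le.1 (hbd x (hs2 hx))).2).trans (hexp _ (by linarith [hθ.2]))

/-- The lower constant comparing the squared sup norm and the `L²` norm of a solution. -/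
noncomputable def equipartitionLower (N : ℝ) : ℝ :=
  (Real.pi - 2 * N ^ (-(1 / 4) : ℝ)) * ((Real.exp (7 / N * Real.pi))⁻¹ -
    7 / N * (Real.exp (7 / N * Real.pi) / (2 * N))) - Real.exp (7 / N * Real.pi) / N

/-- The upper constant comparing the squared sup norm and the `L²` norm of a solution. -/
noncomputable def equipartitionUpper (N : ℝ) : ℝ :=
  (Real.pi - 2 * N ^ (-(1 / 4) : ℝ)) * (Real.exp (7 / N * Real.pi) +
    7 / N * (Real.exp (7 / N * Real.pi) / (2 * N))) + Real.exp (7 / N * Real.pi) / N +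
    4 * N ^ (-(1 / 4) : ℝ) * Real.exp (7 / N * Real.pi)

lemma equipartition_bounds (hA : A ∈ Icc (0 : ℝ) (1 / 8)) (hB : B ∈ Icc (0 : ℝ) (1 / 8))
    (hN : 16 ≤ N) (hcont : ContinuousOn u (Icc 0 Real.pi))
    (hu : ∀ θ ∈ Ioo 0 Real.pi, HasDerivAt u (v θ) θ)
    (hv : ∀ θ ∈ Ioo 0 Real.pi, HasDerivAt v (-(jacobiPotential A B N θ * u θ)) θ)
    {S : ℝ} (hS : IsGreatest ((fun θ => |u θ|) '' Icc 0 Real.pi) S) :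
    equipartitionLower N * S ^ 2 ≤
        Real.exp (7 / N * Real.pi) * ∫ θ in (0 : ℝ)..Real.pi, 2 * u θ ^ 2 ∧
      ∫ θ in (0 : ℝ)..Real.pi, 2 * u θ ^ 2 ≤
        equipartitionUpper N * (Real.exp (7 / N * Real.pi) * S ^ 2) := by
  have hpi := Real.pi_gt_three
  have hN0 : 0 < N := by linarith
  rw [equipartitionLower, equipartitionUpper]
  set δ : ℝ := N ^ (-(1 / 4) : ℝ) with hδdef
  set e : ℝ := Real.exp (7 / N * Real.pi) with hedef
  have hδ : 0 < δ := by positivity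
  have hδ4 : δ ^ 4 = 1 / N := by
    rw [hδdef, ← Real.rpow_natCast, ← Real.rpow_mul hN0.le]
    norm_num
    exact Real.rpow_neg_one N
  have hδ2 : δ ≤ 1 / 2 := by
    refine le_of_pow_le_pow_left₀ (n := 4) (by norm_num) (by norm_num) ?_
    rw [hδ4, div_le_iff₀ hN0]
    linarith
  have hκ : 7 / (δ ^ 4 * N ^ 2) = 7 / N := by
    rw [hδ4]
    field_simp
  have he : 0 < e := Real.exp_pos _
  set φ := jacobiPotential A B N with hφdef
  set E₀ := soninEnergy u v φ (Real.pi / 2) with hE₀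
  have hmid : Real.pi / 2 ∈ Ioo 0 Real.pi := ⟨by linarith, by linarith⟩
  have hφN : ∀ x ∈ Ioo 0 Real.pi, N ^ 2 ≤ φ x := fun x hx =>
    sq_le_jacobiPotential hA.1 hB.1 hx
  have hpos : ∀ x ∈ Ioo 0 Real.pi, 0 < φ x := fun x hx =>
    lt_of_lt_of_le (by positivity) (hφN x hx)
  have hE₀nn : 0 ≤ E₀ := soninEnergy_nonneg (hpos _ hmid)
  have hs : Icc δ (Real.pi - δ) ⊆ Ioo 0 Real.pi := fun x hx =>
    ⟨by linarith [hx.1], by linarith [hx.2]⟩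
  have hup : ∀ x ∈ Ioo 0 Real.pi, soninEnergy u v φ x ≤ e * E₀ := fun x hx => by
    refine (soninEnergy_le_exp_mul_midpoint hA hB hN0 hu hv hx).trans ?_
    have : 1 / N ^ 2 ≤ 7 / N := by
      rw [div_le_div_iff₀ (by positivity) hN0]
      nlinarith
    rw [hedef]
    gcongr
  have hlow : ∀ x ∈ Icc δ (Real.pi - δ), E₀ ≤ e * soninEnergy u v φ x := fun x hx => by
    have := midpoint_le_exp_mul_soninEnergy hA hB hN0 hu hv hδ (by linarith) hx
    rwa [hκ] at this
  have husq : ∀ x ∈ Icc 0 Real.pi, u x ^ 2 ≤ e * E₀ := by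
    have hcl := closure_Ioo (a := 0) (b := Real.pi) Real.pi_pos.ne
    intro x hx
    rw [← hcl] at hx hcont
    exact le_on_closure (fun y hy => (sq_le_soninEnergy (hpos y hy)).trans (hup y hy))
      (hcont.pow 2) continuousOn_const hx
  have hSup : S ^ 2 ≤ e * E₀ := by
    obtain ⟨x, hx, rfl⟩ := hS.1
    simpa using husq x hx
  have hSlow : E₀ ≤ e * S ^ 2 := by
    obtain ⟨x, hx, hxe⟩ := exists_soninEnergy_eq_sq hN0 (a := δ) (b := Real.pi - δ) (φ := φ)
      (by
        have : Real.pi / N ≤ Real.pi / 16 := by gcongr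
        linarith)
      (fun x hx => hu x (hs hx)) (fun x hx => hv x (hs hx)) (fun x hx => hφN x (hs hx))
    refine (hlow x hx).trans ?_
    rw [hxe]
    have h1 : |u x| ≤ S := hS.2 ⟨x, Ioo_subset_Icc_self (hs hx), rfl⟩
    rw [← sq_abs]
    gcongr
  have hcore := integral_two_mul_sq_mem_Icc (a := δ) (b := Real.pi - δ) (N := N) (κ := 7 / N)
    (m := e⁻¹ * E₀) (M := e * E₀) (by linarith) hN0
    (fun x hx => hu x (hs hx)) (fun x hx => hv x (hs hx))
    (fun x hx => hasDerivAt_jacobiPotential A B N (hs hx)) (fun x hx => hφN x (hs hx))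
    (fun x hx => by
      have := abs_jacobiPotentialDeriv_le_mul hA hB hN0 hδ hx
      rwa [hκ] at this)
    (fun x hx => by
      rw [inv_mul_le_iff₀ he]
      exact hlow x hx)
    (fun x hx => hup x (hs hx))
  have hu_int : ∀ a ∈ Icc 0 Real.pi, ∀ b ∈ Icc 0 Real.pi,
      IntervalIntegrable (fun θ => 2 * u θ ^ 2) volume a b := fun a ha b hb =>
    ((continuousOn_const.mul (hcont.pow 2)).mono (uIcc_subset_Icc ha hb)).intervalIntegrable
  have m0 : (0 : ℝ) ∈ Icc 0 Real.pi := ⟨le_rfl, by linarith⟩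
  have m1 : δ ∈ Icc 0 Real.pi := ⟨hδ.le, by linarith⟩
  have m2 : Real.pi - δ ∈ Icc 0 Real.pi := ⟨by linarith, by linarith⟩
  have m3 : Real.pi ∈ Icc 0 Real.pi := ⟨by linarith, le_rfl⟩
  have hsplit := intervalIntegral.integral_add_adjacent_intervals (hu_int 0 m0 δ m1)
    (hu_int δ m1 (Real.pi - δ) m2)
  have hsplit2 := intervalIntegral.integral_add_adjacent_intervals (hu_int 0 m0 (Real.pi - δ) m2)
    (hu_int (Real.pi - δ) m2 Real.pi m3)
  have htail : ∀ a ∈ Icc 0 Real.pi, ∀ b ∈ Icc 0 Real.pi, a ≤ b →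
      ∫ θ in a..b, 2 * u θ ^ 2 ∈ Icc 0 ((b - a) * (2 * (e * E₀))) := by
    intro a ha b hb hab
    refine ⟨intervalIntegral.integral_nonneg hab fun x _ => by positivity, ?_⟩
    have := intervalIntegral.integral_mono_on hab (hu_int a ha b hb)
      (intervalIntegrable_const (c := 2 * (e * E₀))) fun x hx => by
        have := husq x ⟨ha.1.trans hx.1, hx.2.trans hb.2⟩
        linarith
    rwa [intervalIntegral.integral_const, smul_eq_mul] at this
  have t1 := htail 0 m0 δ m1 hδ.le
  have t2 := htail (Real.pi - δ) m2 Real.pi m3 (by linarith)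
  have hI0 := (htail 0 m0 Real.pi m3 (by linarith)).1
  have hlo : ((Real.pi - 2 * δ) * (e⁻¹ - 7 / N * (e / (2 * N))) - e / N) * E₀ ≤
      ∫ θ in (0 : ℝ)..Real.pi, 2 * u θ ^ 2 := by
    refine le_trans (le_of_eq ?_) (show _ ≤ _ from hcore.1.trans (by linarith [t1.1, t2.1]))
    ring
  have hhi : ∫ θ in (0 : ℝ)..Real.pi, 2 * u θ ^ 2 ≤
      ((Real.pi - 2 * δ) * (e + 7 / N * (e / (2 * N))) + e / N + 4 * δ * e) * E₀ := by
    rw [← hsplit2, ← hsplit]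
    refine (add_le_add (add_le_add t1.2 hcore.2) t2.2).trans (le_of_eq ?_)
    ring
  constructor
  · rcases le_total 0 ((Real.pi - 2 * δ) * (e⁻¹ - 7 / N * (e / (2 * N))) - e / N) with h | h
    · refine (mul_le_mul_of_nonneg_left hSup h).trans ?_
      rw [mul_left_comm]
      exact mul_le_mul_of_nonneg_left hlo he.le
    · exact (mul_nonpos_of_nonpos_of_nonneg h (sq_nonneg S)).trans (by positivity)
  · refine hhi.trans (mul_le_mul_of_nonneg_left hSlow ?_)
    have : 0 ≤ Real.pi - 2 * δ := by linarith
    positivity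

lemma tendsto_exp_seven_div : Tendsto (fun N : ℝ => Real.exp (7 / N * Real.pi)) atTop (nhds 1) := by
  have h : Tendsto (fun N : ℝ => 7 / N * Real.pi) atTop (nhds (0 * Real.pi)) :=
    (tendsto_id.const_div_atTop 7).mul_const _
  rw [zero_mul] at h
  simpa using h.rexp

lemma tendsto_equipartitionLower : Tendsto equipartitionLower atTop (nhds Real.pi) := by
  have h1 := tendsto_rpow_neg_atTop (show (0 : ℝ) < 1 / 4 by norm_num)
  have he := tendsto_exp_seven_div
  have h7 : Tendsto (fun N : ℝ => 7 / N) atTop (nhds 0) := tendsto_id.const_div_atTop 7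
  have h2 : Tendsto (fun N : ℝ => 2 * N) atTop atTop := tendsto_id.const_mul_atTop two_pos
  have := (((h1.const_mul 2).const_sub Real.pi).mul ((he.inv₀ one_ne_zero).sub
    (h7.mul (he.div_atTop h2)))).sub (he.div_atTop tendsto_id)
  change Tendsto (fun N => equipartitionLower N) atTop _
  simp only [equipartitionLower]
  simpa using this

lemma tendsto_equipartitionUpper : Tendsto equipartitionUpper atTop (nhds Real.pi) := by
  have h1 := tendsto_rpow_neg_atTop (show (0 : ℝ) < 1 / 4 by norm_num)
  have he := tendsto_exp_seven_div
  have h7 : Tendsto (fun N : ℝ => 7 / N) atTop (nhds 0) := tendsto_id.const_div_atTop 7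
  have h2 : Tendsto (fun N : ℝ => 2 * N) atTop atTop := tendsto_id.const_mul_atTop two_pos
  have := ((((h1.const_mul 2).const_sub Real.pi).mul (he.add
    (h7.mul (he.div_atTop h2)))).add (he.div_atTop tendsto_id)).add ((h1.const_mul 4).mul he)
  change Tendsto (fun N => equipartitionUpper N) atTop _
  simp only [equipartitionUpper]
  simpa using this

end Trigonometric

section Liouville

open Set Polynomial

/-- The Liouville normal form of a polynomial with respect to the Jacobi equation. -/
noncomputable def liouvilleForm (α β : ℝ) (p : ℝ[X]) (θ : ℝ) : ℝ :=
  jacobiWeight (α / 2 + 1 / 4) (β / 2 + 1 / 4) (Real.cos θ) * p.eval (Real.cos θ)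

/-- The logarithmic derivative of the weight in `liouvilleForm`. -/
noncomputable def liouvilleLogDeriv (α β θ : ℝ) : ℝ :=
  (α / 2 + 1 / 4) * (Real.sin θ / (1 - Real.cos θ)) -
    (β / 2 + 1 / 4) * (Real.sin θ / (1 + Real.cos θ))

/-- The derivative of `liouvilleForm`. -/
noncomputable def liouvilleDeriv (α β : ℝ) (p : ℝ[X]) (θ : ℝ) : ℝ :=
  jacobiWeight (α / 2 + 1 / 4) (β / 2 + 1 / 4) (Real.cos θ) *
    (liouvilleLogDeriv α β θ * p.eval (Real.cos θ) -
      Real.sin θ * (derivative p).eval (Real.cos θ))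

variable {α β : ℝ} {n : ℕ} {p : ℝ[X]} {θ : ℝ}

lemma hasDerivAt_eval_cos (p : ℝ[X]) (θ : ℝ) :
    HasDerivAt (fun θ => p.eval (Real.cos θ))
      ((derivative p).eval (Real.cos θ) * -Real.sin θ) θ :=
  (p.hasDerivAt (Real.cos θ)).comp θ (Real.hasDerivAt_cos θ)

lemma hasDerivAt_jacobiWeight_cos (hθ : θ ∈ Ioo 0 Real.pi) :
    HasDerivAt (fun θ => jacobiWeight (α / 2 + 1 / 4) (β / 2 + 1 / 4) (Real.cos θ))
      (jacobiWeight (α / 2 + 1 / 4) (β / 2 + 1 / 4) (Real.cos θ) * liouvilleLogDeriv α β θ) θ := by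
  obtain ⟨h1, h2⟩ := cos_mem_Ioo hθ
  have hx1 : 0 < 1 - Real.cos θ := by linarith
  have hx2 : 0 < 1 + Real.cos θ := by linarith
  have d1 := ((Real.hasDerivAt_cos θ).const_sub 1).rpow_const (p := α / 2 + 1 / 4) (.inl hx1.ne')
  have d2 := ((Real.hasDerivAt_cos θ).const_add 1).rpow_const (p := β / 2 + 1 / 4) (.inl hx2.ne')
  refine (d1.mul d2).congr_deriv ?_
  rw [jacobiWeight, liouvilleLogDeriv, Real.rpow_sub_one hx1.ne', Real.rpow_sub_one hx2.ne']
  ring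

lemma hasDerivAt_liouvilleForm (hθ : θ ∈ Ioo 0 Real.pi) :
    HasDerivAt (liouvilleForm α β p) (liouvilleDeriv α β p θ) θ := by
  refine ((hasDerivAt_jacobiWeight_cos hθ).mul (hasDerivAt_eval_cos p θ)).congr_deriv ?_
  rw [liouvilleDeriv]
  ring

lemma hasDerivAt_liouvilleLogDeriv (hθ : θ ∈ Ioo 0 Real.pi) :
    HasDerivAt (liouvilleLogDeriv α β)
      (-((α / 2 + 1 / 4) / (1 - Real.cos θ)) - (β / 2 + 1 / 4) / (1 + Real.cos θ)) θ := by
  obtain ⟨h1, h2⟩ := cos_mem_Ioo hθ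
  have hx1 : 1 - Real.cos θ ≠ 0 := by linarith
  have hx2 : 1 + Real.cos θ ≠ 0 := by linarith
  have d1 := ((Real.hasDerivAt_sin θ).div ((Real.hasDerivAt_cos θ).const_sub 1) hx1).const_mul
    (α / 2 + 1 / 4)
  have d2 := ((Real.hasDerivAt_sin θ).div ((Real.hasDerivAt_cos θ).const_add 1) hx2).const_mul
    (β / 2 + 1 / 4)
  refine (d1.sub d2).congr_deriv ?_
  have e1 : (Real.cos θ * (1 - Real.cos θ) - Real.sin θ * - -Real.sin θ) / (1 - Real.cos θ) ^ 2 =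
      -(1 / (1 - Real.cos θ)) := by
    rw [neg_neg, ← sq, Real.sin_sq]
    field_simp
    ring
  have e2 : (Real.cos θ * (1 + Real.cos θ) - Real.sin θ * -Real.sin θ) / (1 + Real.cos θ) ^ 2 =
      1 / (1 + Real.cos θ) := by
    rw [mul_neg, ← sq, Real.sin_sq]
    field_simp
    ring
  rw [e1, e2]
  ring

lemma IsMonicJacobi.hasDerivAt_liouvilleDeriv (hα : -1 < α) (hβ : -1 < β)
    (hp : IsMonicJacobi α β n p) (hθ : θ ∈ Ioo 0 Real.pi) :
    HasDerivAt (liouvilleDeriv α β p)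
      (-(jacobiPotential ((1 / 4 - α ^ 2) / 2) ((1 / 4 - β ^ 2) / 2) (n + (α + β + 1) / 2) θ *
        liouvilleForm α β p θ)) θ := by
  obtain ⟨h1, h2⟩ := cos_mem_Ioo hθ
  have hx1 : 1 - Real.cos θ ≠ 0 := by linarith
  have hx2 : 1 + Real.cos θ ≠ 0 := by linarith
  refine ((hasDerivAt_jacobiWeight_cos hθ).mul
    (((hasDerivAt_liouvilleLogDeriv hθ).mul (hasDerivAt_eval_cos p θ)).sub
      ((Real.hasDerivAt_sin θ).mul (hasDerivAt_eval_cos (Polynomial.derivative p) θ)))).congr_deriv ?_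
  have hode := congrArg (eval (Real.cos θ)) (hp.jacobiAdjoint_derivative hα hβ)
  simp only [jacobiAdjoint, eval_add, eval_mul, eval_sub, eval_one, eval_pow, eval_X,
    eval_C] at hode
  have hs := Real.sin_sq θ
  have hLs : 2 * liouvilleLogDeriv α β θ * Real.sin θ =
      (α - β) + (α + β + 1) * Real.cos θ := by
    have : 2 * liouvilleLogDeriv α β θ * Real.sin θ =
      2 * (α / 2 + 1 / 4) * (Real.sin θ ^ 2 / (1 - Real.cos θ)) -
        2 * (β / 2 + 1 / 4) * (Real.sin θ ^ 2 / (1 + Real.cos θ)) := by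
      rw [liouvilleLogDeriv]
      ring
    rw [this, hs]
    field_simp
    ring
  have hL2 : liouvilleLogDeriv α β θ ^ 2 +
      (-((α / 2 + 1 / 4) / (1 - Real.cos θ)) - (β / 2 + 1 / 4) / (1 + Real.cos θ)) -
      n * (n + α + β + 1) =
      -jacobiPotential ((1 / 4 - α ^ 2) / 2) ((1 / 4 - β ^ 2) / 2) (n + (α + β + 1) / 2) θ := by
    have : liouvilleLogDeriv α β θ ^ 2 = Real.sin θ ^ 2 *
        ((α / 2 + 1 / 4) / (1 - Real.cos θ) - (β / 2 + 1 / 4) / (1 + Real.cos θ)) ^ 2 := by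
      rw [liouvilleLogDeriv]
      ring
    rw [this, hs, jacobiPotential]
    field_simp
    ring
  rw [liouvilleForm]
  simp only [Pi.mul_apply, Pi.sub_apply]
  set W := jacobiWeight (α / 2 + 1 / 4) (β / 2 + 1 / 4) (Real.cos θ)
  linear_combination W * hode + W * p.eval (Real.cos θ) * hL2 -
    W * (Polynomial.derivative p).eval (Real.cos θ) * hLs +
    W * (Polynomial.derivative (Polynomial.derivative p)).eval (Real.cos θ) * hs

lemma continuous_liouvilleForm (hα : -(1 : ℝ) / 2 ≤ α) (hβ : -(1 : ℝ) / 2 ≤ β) :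
    Continuous (liouvilleForm α β p) := by
  refine Continuous.mul (Continuous.mul ?_ ?_) (p.continuous.comp Real.continuous_cos)
  · exact (continuous_const.sub Real.continuous_cos).rpow_const fun x => .inr (by linarith)
  · exact (continuous_const.add Real.continuous_cos).rpow_const fun x => .inr (by linarith)

lemma isGreatest_jacobiSup (hα : -(1 : ℝ) / 2 ≤ α) (hβ : -(1 : ℝ) / 2 ≤ β) :
    IsGreatest ((fun θ => |liouvilleForm α β p θ|) '' Icc 0 Real.pi)
      (jacobiSup (α / 2 + 1 / 4) (β / 2 + 1 / 4) p) := by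
  have himg : (fun x : ℝ => (1 - x) ^ (α / 2 + 1 / 4) * (1 + x) ^ (β / 2 + 1 / 4) * |p.eval x|) ''
      Icc (-1 : ℝ) 1 = (fun θ => |liouvilleForm α β p θ|) '' Icc 0 Real.pi := by
    rw [← Real.bijOn_cos.image_eq, image_image]
    refine image_congr fun θ _ => ?_
    have h1 : 0 ≤ 1 - Real.cos θ := by linarith [Real.cos_le_one θ]
    have h2 : 0 ≤ 1 + Real.cos θ := by linarith [Real.neg_one_le_cos θ]
    rw [liouvilleForm, jacobiWeight, abs_mul,
      abs_of_nonneg (mul_nonneg (Real.rpow_nonneg h1 (α / 2 + 1 / 4))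
        (Real.rpow_nonneg h2 (β / 2 + 1 / 4)))]
  rw [jacobiSup, himg]
  exact (isCompact_Icc.image (continuous_liouvilleForm hα hβ).abs).isGreatest_sSup
    ((nonempty_Icc.2 Real.pi_pos.le).image _)

lemma image_cos_Ioo : Real.cos '' Ioo 0 Real.pi = Ioo (-1) 1 := by
  ext x
  constructor
  · rintro ⟨θ, hθ, rfl⟩
    exact cos_mem_Ioo hθ
  · intro hx
    exact ⟨Real.arccos x, ⟨Real.arccos_pos.2 hx.2, Real.arccos_lt_pi.2 hx.1⟩,
      Real.cos_arccos hx.1.le hx.2.le⟩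

lemma integral_liouvilleForm_sq :
    ∫ θ in (0 : ℝ)..Real.pi, liouvilleForm α β p θ ^ 2 = jacobiIntegral α β (p * p) := by
  rw [jacobiIntegral, intervalIntegral.integral_of_le Real.pi_pos.le,
    intervalIntegral.integral_of_le (by norm_num), integral_Ioc_eq_integral_Ioo,
    integral_Ioc_eq_integral_Ioo, ← image_cos_Ioo,
    integral_image_eq_integral_abs_deriv_smul measurableSet_Ioo
      (fun θ _ => (Real.hasDerivAt_cos θ).hasDerivWithinAt)
      (Real.injOn_cos.mono Ioo_subset_Icc_self)]
  refine setIntegral_congr_fun measurableSet_Ioo fun θ hθ => ?_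
  obtain ⟨h1, h2⟩ := cos_mem_Ioo hθ
  have hx1 : 0 < 1 - Real.cos θ := by linarith
  have hx2 : 0 < 1 + Real.cos θ := by linarith
  have hs := Real.sin_pos_of_pos_of_lt_pi hθ.1 hθ.2
  have hsin : Real.sin θ = (1 - Real.cos θ) ^ (1 / 2 : ℝ) * (1 + Real.cos θ) ^ (1 / 2 : ℝ) := by
    rw [← Real.mul_rpow hx1.le hx2.le, ← Real.sqrt_eq_rpow, eq_comm,
      Real.sqrt_eq_iff_mul_self_eq_of_pos hs, ← sq, Real.sin_sq]
    ring
  have e : ∀ {x γ : ℝ}, 0 < x → (x ^ (γ / 2 + 1 / 4)) ^ 2 = x ^ (1 / 2 : ℝ) * x ^ γ := by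
    intro x γ hx
    rw [← Real.rpow_natCast, ← Real.rpow_mul hx.le, ← Real.rpow_add hx]
    congr 1
    push_cast
    ring
  simp only [smul_eq_mul, abs_neg, abs_of_pos hs, liouvilleForm, jacobiWeight, eval_mul, mul_pow,
    e hx1, e hx2]
  rw [hsin]
  ring

end Liouville

theorem jacobi_weighted_sup_asymptotics
    (α β : ℝ) (hα : α ∈ Set.Icc (-(1 : ℝ) / 2) (1 / 2))
    (hβ : β ∈ Set.Icc (-(1 : ℝ) / 2) (1 / 2))
    (P : ℕ → Polynomial ℝ) (hP : ∀ n : ℕ, 1 ≤ n → IsMonicJacobi α β n (P n)) :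
    Tendsto (fun n : ℕ =>
        (2 : ℝ) ^ ((n : ℝ) - 1 + (α / 2 + 1 / 4) + (β / 2 + 1 / 4)) *
          jacobiSup (α / 2 + 1 / 4) (β / 2 + 1 / 4) (P n))
      atTop (nhds 1) := by
  have hα1 : -1 < α := by linarith [hα.1]
  have hβ1 : -1 < β := by linarith [hβ.1]
  set S : ℕ → ℝ := fun n => jacobiSup (α / 2 + 1 / 4) (β / 2 + 1 / 4) (P n) with hSdef
  set N : ℕ → ℝ := fun n => n + (α + β + 1) / 2 with hNdef
  set J : ℕ → ℝ := fun n => jacobiIntegral α β (P n * P n) with hJdef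
  have hN : Tendsto N atTop atTop := tendsto_atTop_add_const_right _ _ tendsto_natCast_atTop_atTop
  have hS0 : ∀ n, 0 ≤ S n := fun n => by
    obtain ⟨θ, -, hθ⟩ := (isGreatest_jacobiSup (p := P n) hα.1 hβ.1).1
    exact le_of_le_of_eq (abs_nonneg _) hθ
  have hparam : ∀ γ ∈ Set.Icc (-(1 : ℝ) / 2) (1 / 2),
      (1 / 4 - γ ^ 2) / 2 ∈ Set.Icc (0 : ℝ) (1 / 8) := by
    intro γ hγ
    constructor <;> nlinarith [hγ.1, hγ.2, sq_nonneg γ]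
  have hbounds : ∀ᶠ n in atTop,
      equipartitionLower (N n) * S n ^ 2 ≤ Real.exp (7 / N n * Real.pi) * (2 * J n) ∧
        2 * J n ≤ equipartitionUpper (N n) * (Real.exp (7 / N n * Real.pi) * S n ^ 2) := by
    filter_upwards [hN.eventually_ge_atTop 16, eventually_ge_atTop 1] with n hn hn1
    have := equipartition_bounds (hparam α hα) (hparam β hβ) hn
      (continuous_liouvilleForm (p := P n) hα.1 hβ.1).continuousOn
      (fun θ hθ => hasDerivAt_liouvilleForm hθ)
      (fun θ hθ => (hP n hn1).hasDerivAt_liouvilleDeriv hα1 hβ1 hθ)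
      (isGreatest_jacobiSup hα.1 hβ.1)
    rwa [intervalIntegral.integral_const_mul, integral_liouvilleForm_sq] at this
  have hJ : Tendsto (fun n => 2 ^ (α + β) * (4 ^ n * J n)) atTop (nhds Real.pi) := by
    have := (tendsto_four_pow_mul_jacobiIntegral hα1 hβ1 hP).const_mul (2 ^ (α + β))
    rwa [mul_left_comm, ← Real.rpow_add two_pos, add_neg_cancel, Real.rpow_zero, mul_one] at this
  have hexp := tendsto_exp_seven_div.comp hN
  have hlower := tendsto_equipartitionLower.comp hN
  have hupper := tendsto_equipartitionUpper.comp hN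
  have hpow : ∀ n : ℕ, ((2 : ℝ) ^ ((n : ℝ) - 1 + (α / 2 + 1 / 4) + (β / 2 + 1 / 4)) * S n) ^ 2 =
      2 ^ (α + β) * 4 ^ n / 2 * S n ^ 2 := by
    intro n
    rw [mul_pow, ← Real.rpow_natCast, ← Real.rpow_mul two_pos.le]
    congr 1
    rw [show ((n : ℝ) - 1 + (α / 2 + 1 / 4) + (β / 2 + 1 / 4)) * ((2 : ℕ) : ℝ) =
      α + β + 2 * n - 1 by push_cast; ring, Real.rpow_sub_one two_ne_zero,
      Real.rpow_add two_pos, Real.rpow_mul two_pos.le, Real.rpow_natCast]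
    norm_num
  have hsq : Tendsto (fun n : ℕ =>
      ((2 : ℝ) ^ ((n : ℝ) - 1 + (α / 2 + 1 / 4) + (β / 2 + 1 / 4)) * S n) ^ 2) atTop (nhds 1) := by
    have hlo := hJ.div (hupper.mul hexp) (by simp [Real.pi_ne_zero])
    have hhi := (hexp.mul hJ).div hlower Real.pi_ne_zero
    rw [mul_one, div_self Real.pi_ne_zero] at hlo
    rw [one_mul, div_self Real.pi_ne_zero] at hhi
    refine tendsto_of_tendsto_of_tendsto_of_le_of_le' hlo hhi ?_ ?_
    · filter_upwards [hbounds, hupper.eventually_const_lt Real.pi_pos] with n hn hpos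
      have hc : (0 : ℝ) ≤ 2 ^ (α + β) * 4 ^ n / 2 := by positivity
      have hpos' : 0 < equipartitionUpper (N n) * Real.exp (7 / N n * Real.pi) :=
        mul_pos hpos (Real.exp_pos _)
      rw [hpow]
      refine (div_le_iff₀ hpos').2 ?_
      linarith [mul_le_mul_of_nonneg_left hn.2 hc]
    · filter_upwards [hbounds, hlower.eventually_const_lt Real.pi_pos] with n hn hpos
      have hc : (0 : ℝ) ≤ 2 ^ (α + β) * 4 ^ n / 2 := by positivity
      rw [hpow]
      refine (le_div_iff₀ hpos).2 ?_
      simp only [Function.comp_apply]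
      linarith [mul_le_mul_of_nonneg_left hn.1 hc]
  have := hsq.sqrt
  rw [Real.sqrt_one] at this
  refine this.congr fun n => Real.sqrt_sq ?_
  have := hS0 n
  positivity
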